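/- Let k ∈ ℕ and let f : ℝ^d × ℝ^d → ℂ be measurable with ‖f‖_{X_{k+1}} < ∞. Then the time integral of the X_k-norm of the free transport semigroup applied to f is finite and satisfies ∫₀^∞ ‖U₀(t)f‖_{X_k} dt ≤ D · ‖f‖_{X_{k+1}}, i.e. ∫₀^∞ ( ∫_{Ω×ℝ^d} max(1,|v|^{−k}) |f(x − t·v, v)|·1_{{t < t₋(x,v)}} dx m(dv) ) dt ≤ D ∫_{Ω×ℝ^d} max(1,|v|^{−(k+1)}) |f(x,v)| dx m(dv). -/

import Mathlib

open MeasureTheory Set Filter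
open scoped ENNReal NNReal Topology

/-- The backward exit time `t₋(x,v) = inf {s > 0 : x - s • v ∉ Ω}` (with `inf ∅ = ∞`),
valued in `ℝ≥0∞`. -/
noncomputable def tminus {d : ℕ} (Ω : Set (EuclideanSpace ℝ (Fin d)))
    (x v : EuclideanSpace ℝ (Fin d)) : ℝ≥0∞ :=
  ⨅ (s : ℝ) (_ : 0 < s ∧ x - s • v ∉ Ω), ENNReal.ofReal s

/-- The norm `‖f‖_{X_s} = ∫_{Ω×ℝ^d} max(1,|v|^{-s}) |f(x,v)| dx m(dv)`. -/
noncomputable def Xnorm {d : ℕ} (Ω : Set (EuclideanSpace ℝ (Fin d)))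
    (m : Measure (EuclideanSpace ℝ (Fin d))) (s : ℕ)
    (f : EuclideanSpace ℝ (Fin d) → EuclideanSpace ℝ (Fin d) → ℂ) : ℝ≥0∞ :=
  ∫⁻ x in Ω, ∫⁻ v, ENNReal.ofReal (max 1 (‖v‖⁻¹ ^ s)) * (‖f x v‖₊ : ℝ≥0∞) ∂m

/-- The free transport semigroup `(U₀(t)f)(x,v) = f(x - t v, v) 1_{t < t₋(x,v)}`. -/
noncomputable def freeTransport {d : ℕ} (Ω : Set (EuclideanSpace ℝ (Fin d)))
    (t : ℝ) (f : EuclideanSpace ℝ (Fin d) → EuclideanSpace ℝ (Fin d) → ℂ)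
    (x v : EuclideanSpace ℝ (Fin d)) : ℂ :=
  if ENNReal.ofReal t < tminus Ω x v then f (x - t • v) v else 0

/-- A particle that has not left `Ω` at time `t > 0` comes from a point of `Ω`. -/
lemma sub_smul_mem_of_lt_tminus {d : ℕ} {Ω : Set (EuclideanSpace ℝ (Fin d))}
    {x v : EuclideanSpace ℝ (Fin d)} {t : ℝ} (ht : 0 < t)
    (h : ENNReal.ofReal t < tminus Ω x v) : x - t • v ∈ Ω := by
  by_contra hx
  exact absurd h (not_lt.2 (iInf₂_le t ⟨ht, hx⟩))

/-- In a bounded set, free transport is controlled by translation of `f` restricted to `Ω`, and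
it vanishes once `t ‖v‖` exceeds the diameter. -/
lemma nnnorm_freeTransport_le {d : ℕ} {Ω : Set (EuclideanSpace ℝ (Fin d))}
    (hΩ : Bornology.IsBounded Ω)
    (f : EuclideanSpace ℝ (Fin d) → EuclideanSpace ℝ (Fin d) → ℂ)
    {x v : EuclideanSpace ℝ (Fin d)} (hx : x ∈ Ω) {t : ℝ} (ht : 0 < t) :
    (‖freeTransport Ω t f x v‖₊ : ℝ≥0∞) ≤
      {v : EuclideanSpace ℝ (Fin d) | t * ‖v‖ ≤ Metric.diam Ω}.indicator 1 v *
        Ω.indicator (fun y => (‖f y v‖₊ : ℝ≥0∞)) (x - t • v) := by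
  unfold freeTransport
  split_ifs with h
  · have hy := sub_smul_mem_of_lt_tminus ht h
    have hd : t * ‖v‖ ≤ Metric.diam Ω := by
      have := Metric.dist_le_diam_of_mem hΩ hx hy
      rwa [dist_eq_norm, sub_sub_cancel, norm_smul, Real.norm_of_nonneg ht.le] at this
    simp [hy, hd]
  · simp

lemma measurable_indicator_nnnorm {d : ℕ} {Ω : Set (EuclideanSpace ℝ (Fin d))}
    (hΩ : MeasurableSet Ω)
    {f : EuclideanSpace ℝ (Fin d) → EuclideanSpace ℝ (Fin d) → ℂ}
    (hf : Measurable (Function.uncurry f)) :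
    Measurable fun p : EuclideanSpace ℝ (Fin d) × EuclideanSpace ℝ (Fin d) =>
      Ω.indicator (fun y => (‖f y p.2‖₊ : ℝ≥0∞)) p.1 :=
  Measurable.indicator (f := fun p => (‖Function.uncurry f p‖₊ : ℝ≥0∞))
    hf.nnnorm.coe_nnreal_ennreal (measurable_fst hΩ)

/-- The `X_s`-norm with the velocity integral outermost. -/
lemma Xnorm_eq_lintegral_velocity {d : ℕ} {Ω : Set (EuclideanSpace ℝ (Fin d))}
    (m : Measure (EuclideanSpace ℝ (Fin d))) [SFinite m]
    (hΩ : MeasurableSet Ω) (s : ℕ)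
    {f : EuclideanSpace ℝ (Fin d) → EuclideanSpace ℝ (Fin d) → ℂ}
    (hf : Measurable (Function.uncurry f)) :
    Xnorm Ω m s f = ∫⁻ v, ENNReal.ofReal (max 1 (‖v‖⁻¹ ^ s)) *
      (∫⁻ x, Ω.indicator (fun y => (‖f y v‖₊ : ℝ≥0∞)) x) ∂m := by
  have hf' := hf.nnnorm.coe_nnreal_ennreal
  unfold Xnorm
  rw [lintegral_lintegral_swap]
  · refine lintegral_congr fun v => ?_
    rw [lintegral_const_mul, lintegral_indicator hΩ]
    exact hf'.comp measurable_prodMk_right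
  · exact Measurable.aemeasurable (Measurable.mul (by fun_prop) hf')

/-- The `X_s`-norm at time `t > 0` only sees the velocities with `t ‖v‖ ≤ diam Ω`. -/
lemma Xnorm_freeTransport_le {d : ℕ} {Ω : Set (EuclideanSpace ℝ (Fin d))}
    (m : Measure (EuclideanSpace ℝ (Fin d))) [SFinite m]
    (hΩ : MeasurableSet Ω) (hΩbdd : Bornology.IsBounded Ω) (s : ℕ)
    {f : EuclideanSpace ℝ (Fin d) → EuclideanSpace ℝ (Fin d) → ℂ}
    (hf : Measurable (Function.uncurry f)) {t : ℝ} (ht : 0 < t) :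
    Xnorm Ω m s (freeTransport Ω t f) ≤
      ∫⁻ v, {v : EuclideanSpace ℝ (Fin d) | t * ‖v‖ ≤ Metric.diam Ω}.indicator 1 v *
        (ENNReal.ofReal (max 1 (‖v‖⁻¹ ^ s)) *
          ∫⁻ x, Ω.indicator (fun y => (‖f y v‖₊ : ℝ≥0∞)) x) ∂m := by
  have hF := measurable_indicator_nnnorm hΩ hf
  have hA : MeasurableSet {v : EuclideanSpace ℝ (Fin d) | t * ‖v‖ ≤ Metric.diam Ω} :=
    measurableSet_le (by fun_prop) measurable_const
  calc Xnorm Ω m s (freeTransport Ω t f)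
      ≤ ∫⁻ x in Ω, ∫⁻ v, ENNReal.ofReal (max 1 (‖v‖⁻¹ ^ s)) *
          ({v : EuclideanSpace ℝ (Fin d) | t * ‖v‖ ≤ Metric.diam Ω}.indicator 1 v *
            Ω.indicator (fun y => (‖f y v‖₊ : ℝ≥0∞)) (x - t • v)) ∂m := by
        refine setLIntegral_mono' hΩ fun x hx => lintegral_mono fun v => ?_
        gcongr
        exact nnnorm_freeTransport_le hΩbdd f hx ht
    _ ≤ ∫⁻ x, ∫⁻ v, ENNReal.ofReal (max 1 (‖v‖⁻¹ ^ s)) *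
          ({v : EuclideanSpace ℝ (Fin d) | t * ‖v‖ ≤ Metric.diam Ω}.indicator 1 v *
            Ω.indicator (fun y => (‖f y v‖₊ : ℝ≥0∞)) (x - t • v)) ∂m :=
        setLIntegral_le_lintegral _ _
    _ = _ := by
        rw [lintegral_lintegral_swap]
        · refine lintegral_congr fun v => ?_
          have hv : Measurable (Ω.indicator fun y => (‖f y v‖₊ : ℝ≥0∞)) :=
            hF.comp measurable_prodMk_right
          have hv' : Measurable fun x =>
              Ω.indicator (fun y => (‖f y v‖₊ : ℝ≥0∞)) (x - t • v) :=
            hv.comp (measurable_id.sub_const _)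
          rw [lintegral_const_mul _ (hv'.const_mul _), lintegral_const_mul _ hv',
            lintegral_sub_right_eq_self, mul_left_comm]
        · refine Measurable.aemeasurable (Measurable.mul (by fun_prop) (Measurable.mul ?_ ?_))
          · exact (measurable_one.indicator hA).comp measurable_snd
          · exact hF.comp (f := fun p : EuclideanSpace ℝ (Fin d) × EuclideanSpace ℝ (Fin d) =>
              (p.1 - t • p.2, p.2)) (by fun_prop)

/-- The time a particle of velocity `v ≠ 0` needs to travel a distance `D`. -/
lemma lintegral_indicator_mul_norm_le {E : Type*} [NormedAddCommGroup E] {v : E} (hv : v ≠ 0)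
    (D : ℝ) :
    ∫⁻ t in Set.Ioi (0 : ℝ), {v : E | t * ‖v‖ ≤ D}.indicator (1 : E → ℝ≥0∞) v =
      ENNReal.ofReal (D * ‖v‖⁻¹) := by
  have hpos : 0 < ‖v‖ := norm_pos_iff.2 hv
  have h : (fun t : ℝ => {v : E | t * ‖v‖ ≤ D}.indicator (1 : E → ℝ≥0∞) v) =
      (Set.Iic (D * ‖v‖⁻¹)).indicator 1 := by
    ext t
    simp only [Set.indicator_apply, Set.mem_ofPred_eq, Set.mem_Iic, ← div_eq_mul_inv,
      le_div_iff₀ hpos, Pi.one_apply]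
  rw [h, lintegral_indicator_one measurableSet_Iic, Measure.restrict_apply measurableSet_Iic,
    Set.inter_comm, Set.Ioi_inter_Iic, Real.volume_Ioc, sub_zero]

lemma mul_max_one_pow_le {a : ℝ} (ha : 0 ≤ a) (k : ℕ) :
    a * max 1 (a ^ k) ≤ max 1 (a ^ (k + 1)) := by
  rw [mul_max_of_nonneg _ _ ha, mul_one, ← pow_succ']
  refine max_le ?_ (le_max_right _ _)
  rcases le_total a 1 with h | h
  · exact h.trans (le_max_left _ _)
  · exact (le_self_pow₀ h k.succ_ne_zero).trans (le_max_right _ _)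

/-- Time integrability of the free transport semigroup:
`∫₀^∞ ‖U₀(t)f‖_{X_k} dt ≤ D ‖f‖_{X_{k+1}}` for `f ∈ X_{k+1}`. -/
theorem freeTransport_time_integral {d : ℕ} (hd : 1 ≤ d)
    (Ω : Set (EuclideanSpace ℝ (Fin d))) (hΩopen : IsOpen Ω)
    (hΩne : Ω.Nonempty) (hΩbdd : Bornology.IsBounded Ω)
    (m : Measure (EuclideanSpace ℝ (Fin d))) [SigmaFinite m] (hm0 : m {0} = 0)
    (k : ℕ)
    (f : EuclideanSpace ℝ (Fin d) → EuclideanSpace ℝ (Fin d) → ℂ)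
    (hf : Measurable (Function.uncurry f))
    (hfX : Xnorm Ω m (k + 1) f < ⊤) :
    ∫⁻ t in Set.Ioi (0 : ℝ), Xnorm Ω m k (freeTransport Ω t f)
      ≤ ENNReal.ofReal (Metric.diam Ω) * Xnorm Ω m (k + 1) f := by
  have hΩ := hΩopen.measurableSet
  have hG : Measurable fun v => ∫⁻ x, Ω.indicator (fun y => (‖f y v‖₊ : ℝ≥0∞)) x :=
    (measurable_indicator_nnnorm hΩ hf).lintegral_prod_left'
  have hW : Measurable fun v => ENNReal.ofReal (max 1 (‖v‖⁻¹ ^ k)) *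
      ∫⁻ x, Ω.indicator (fun y => (‖f y v‖₊ : ℝ≥0∞)) x := Measurable.mul (by fun_prop) hG
  have hI : Measurable fun p : ℝ × EuclideanSpace ℝ (Fin d) =>
      {v : EuclideanSpace ℝ (Fin d) | p.1 * ‖v‖ ≤ Metric.diam Ω}.indicator
        (1 : EuclideanSpace ℝ (Fin d) → ℝ≥0∞) p.2 :=
    Measurable.indicator (f := fun _ => (1 : ℝ≥0∞)) measurable_const
      (s := {p : ℝ × EuclideanSpace ℝ (Fin d) | p.1 * ‖p.2‖ ≤ Metric.diam Ω})
      (measurableSet_le (by fun_prop) measurable_const)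
  have hne : ∀ᵐ v ∂m, v ≠ 0 := by
    simpa [ae_iff] using hm0
  refine (setLIntegral_mono' measurableSet_Ioi fun t ht =>
    Xnorm_freeTransport_le m hΩ hΩbdd k hf ht).trans ?_
  rw [lintegral_lintegral_swap (hI.mul (hW.comp measurable_snd)).aemeasurable,
    Xnorm_eq_lintegral_velocity m hΩ (k + 1) hf,
    ← lintegral_const_mul' _ _ ENNReal.ofReal_ne_top]
  refine lintegral_mono_ae (hne.mono fun v hv => ?_)
  have hIv : Measurable fun t : ℝ => {v : EuclideanSpace ℝ (Fin d) | t * ‖v‖ ≤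
      Metric.diam Ω}.indicator (1 : EuclideanSpace ℝ (Fin d) → ℝ≥0∞) v :=
    hI.comp measurable_prodMk_right
  rw [lintegral_mul_const _ hIv,
    lintegral_indicator_mul_norm_le hv, ← mul_assoc, ← mul_assoc,
    ENNReal.ofReal_mul Metric.diam_nonneg, mul_assoc (ENNReal.ofReal (Metric.diam Ω)),
    ← ENNReal.ofReal_mul (by positivity)]
  gcongr
  exact mul_max_one_pow_le (by positivity) k
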